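/- Let G be a finite simple graph such that every connected component of G, viewed as a graph in its own right, admits a 2-uniform 132-avoiding word representing a graph isomorphic to it (i.e., each component is 132-representable by a 2-uniform word). Then G itself admits a 2-uniform 132-avoiding word representing a graph isomorphic to G; in particular, G is 132-representable. -/

import Mathlib

/-- Distinct letters `x` and `y` alternate in the word `w`: the subsequence of `w`
formed by all occurrences of `x` and `y` has no two equal consecutive letters. -/
def Alternate (w : List ℕ) (x y : ℕ) : Prop :=
  (w.filter (fun c => decide (c = x ∨ c = y))).Chain' (· ≠ ·)

/-- The word `w` avoids the pattern 132. -/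
def Avoids132 (w : List ℕ) : Prop :=
  ∀ i j k : Fin w.length, i < j → j < k →
    ¬ (w.get i < w.get k ∧ w.get k < w.get j)

/-- The word `w` represents the simple graph `G`: the vertex set of `G` is the set
`A(w)` of letters of `w` (all other vertices of the ambient type `ℕ` are isolated),
and two distinct letters of `w` are adjacent iff they alternate in `w`. -/
def Represents (w : List ℕ) (G : SimpleGraph ℕ) : Prop :=
  (∀ x y, G.Adj x y → x ∈ w) ∧
  (∀ x y : ℕ, x ≠ y → x ∈ w → y ∈ w → (G.Adj x y ↔ Alternate w x y))

/-- A graph is 132-representable if some simple graph on a set of natural numbers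
isomorphic to it is represented by a 132-avoiding word. -/
def Representable132 {V : Type*} (G : SimpleGraph V) : Prop :=
  ∃ (w : List ℕ) (H : SimpleGraph ℕ), Avoids132 w ∧ Represents w H ∧
    Nonempty (G ≃g H.induce (↑w.toFinset : Set ℕ))

/-- `G` is 132-representable by a 2-uniform word: some graph isomorphic to `G` is
represented by a 132-avoiding word in which every letter occurs exactly twice. -/
def Representable132Uniform2 {V : Type*} (G : SimpleGraph V) : Prop :=
  ∃ (w : List ℕ) (H : SimpleGraph ℕ), Avoids132 w ∧ (∀ x ∈ w, w.count x = 2) ∧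
    Represents w H ∧ Nonempty (G ≃g H.induce (↑w.toFinset : Set ℕ))

theorem alternate_iff_isChain {w : List ℕ} {x y : ℕ} :
    Alternate w x y ↔ (w.filter (fun c => decide (c = x ∨ c = y))).IsChain (· ≠ ·) :=
  Iff.rfl

theorem Alternate.symm {w : List ℕ} {x y : ℕ} (h : Alternate w x y) : Alternate w y x := by
  simpa only [Alternate, or_comm] using h

theorem alternate_append_iff_left {u v : List ℕ} {x y : ℕ} (hx : x ∉ v) (hy : y ∉ v) :
    Alternate (u ++ v) x y ↔ Alternate u x y := by
  have hv : v.filter (fun c => decide (c = x ∨ c = y)) = [] := by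
    rw [List.filter_eq_nil_iff]
    grind
  rw [Alternate, Alternate, List.filter_append, hv, List.append_nil]

theorem alternate_append_iff_right {u v : List ℕ} {x y : ℕ} (hx : x ∉ u) (hy : y ∉ u) :
    Alternate (u ++ v) x y ↔ Alternate v x y := by
  have hu : u.filter (fun c => decide (c = x ∨ c = y)) = [] := by
    rw [List.filter_eq_nil_iff]
    grind
  rw [Alternate, Alternate, List.filter_append, hu, List.nil_append]

theorem alternate_map_iff {f : ℕ → ℕ} (hf : f.Injective) {w : List ℕ} {x y : ℕ} :
    Alternate (w.map f) (f x) (f y) ↔ Alternate w x y := by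
  have hp : (fun c => decide (c = f x ∨ c = f y)) ∘ f = fun c => decide (c = x ∨ c = y) := by
    funext c
    simp [hf.eq_iff]
  rw [alternate_iff_isChain, alternate_iff_isChain, List.filter_map, hp, List.isChain_map]
  simp only [ne_eq, hf.eq_iff]

theorem not_alternate_append {u v : List ℕ} {x y : ℕ} (hx : u.count x = 2) (hy : y ∉ u) :
    ¬ Alternate (u ++ v) x y := by
  intro h
  have hu : u.filter (fun c => decide (c = x ∨ c = y)) = [x, x] := by
    calc u.filter (fun c => decide (c = x ∨ c = y)) = u.filter (· == x) :=
          List.filter_congr (by grind)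
      _ = [x, x] := by rw [List.filter_beq, hx]; rfl
  rw [alternate_iff_isChain, List.filter_append, hu] at h
  simp at h

theorem Avoids132.map {w : List ℕ} (hw : Avoids132 w) {f : ℕ → ℕ} (hf : StrictMono f) :
    Avoids132 (w.map f) := by
  intro i j k hij hjk
  have := hw (i.cast (by simp)) (j.cast (by simp)) (k.cast (by simp)) hij hjk
  simpa [hf.lt_iff_lt] using this

theorem Avoids132.append {u v : List ℕ} (hu : Avoids132 u) (hv : Avoids132 v)
    (huv : ∀ x ∈ u, ∀ y ∈ v, y < x) : Avoids132 (u ++ v) := by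
  rintro ⟨i, hi⟩ ⟨j, hj⟩ ⟨k, hk⟩ hij hjk ⟨h₁, h₂⟩
  simp only [Fin.mk_lt_mk, List.get_eq_getElem] at hij hjk h₁ h₂
  rw [List.length_append] at hi hj hk
  by_cases hiu : i < u.length
  · by_cases hku : k < u.length
    · have hju : j < u.length := hjk.trans hku
      rw [List.getElem_append_left hiu, List.getElem_append_left hku] at h₁
      rw [List.getElem_append_left hju, List.getElem_append_left hku] at h₂
      exact hu ⟨i, hiu⟩ ⟨j, hju⟩ ⟨k, hku⟩ hij hjk ⟨h₁, h₂⟩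
    · rw [List.getElem_append_left hiu, List.getElem_append_right (not_lt.1 hku)] at h₁
      exact absurd h₁ (huv _ (List.getElem_mem _) _ (List.getElem_mem _)).not_gt
  · have hju : u.length ≤ j := by omega
    have hku : u.length ≤ k := by omega
    rw [List.getElem_append_right (not_lt.1 hiu), List.getElem_append_right hku] at h₁
    rw [List.getElem_append_right hku, List.getElem_append_right hju] at h₂
    exact hv ⟨i - u.length, by omega⟩ ⟨j - u.length, by omega⟩ ⟨k - u.length, by omega⟩
      (Fin.mk_lt_mk.2 (by omega)) (Fin.mk_lt_mk.2 (by omega)) ⟨h₁, h₂⟩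

/-- The 2-uniform 132-avoiding word `w` represents the subgraph of `G` induced on `S`, where the
vertex `v` is labelled by `f v`. -/
structure LabelledBy {V : Type*} (G : SimpleGraph V) (S : Set V) (w : List ℕ) (f : V → ℕ) :
    Prop where
  avoids : Avoids132 w
  count_eq_two : ∀ x ∈ w, w.count x = 2
  bijOn : Set.BijOn f S {x | x ∈ w}
  adj_iff : ∀ x ∈ S, ∀ y ∈ S, x ≠ y → (G.Adj x y ↔ Alternate w (f x) (f y))

theorem labelledBy_empty {V : Type*} (G : SimpleGraph V) (f : V → ℕ) : LabelledBy G ∅ [] f where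
  avoids := fun i => i.elim0
  count_eq_two := by simp
  bijOn := by simp
  adj_iff := by simp

theorem Representable132Uniform2.exists_labelledBy {V : Type*} {G : SimpleGraph V} {S : Set V}
    (h : Representable132Uniform2 (G.induce S)) : ∃ w f, LabelledBy G S w f := by
  classical
  obtain ⟨w, H, hw, hc, ⟨-, hH⟩, ⟨e⟩⟩ := h
  let f : V → ℕ := fun v => if h : v ∈ S then e ⟨v, h⟩ else 0
  have hf : ∀ (v : V) (hv : v ∈ S), f v = e ⟨v, hv⟩ := fun v hv => dif_pos hv
  have hmem : ∀ v : S, (e v : ℕ) ∈ w := fun v => by simpa using (e v).2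
  refine ⟨w, f, hw, hc, ⟨fun v hv => ?_, fun x hx y hy hxy => ?_, fun n hn => ?_⟩,
    fun x hx y hy hxy => ?_⟩
  · rw [hf v hv]
    exact hmem _
  · rw [hf x hx, hf y hy] at hxy
    simpa using e.injective (Subtype.ext hxy)
  · obtain ⟨v, hv⟩ := e.surjective ⟨n, by simpa using hn⟩
    exact ⟨v, v.2, by rw [hf v v.2, hv]⟩
  · rw [hf x hx, hf y hy, ← hH _ _ _ (hmem _) (hmem _)]
    · exact (e.map_adj_iff (v := ⟨x, hx⟩) (w := ⟨y, hy⟩)).symm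
    · intro he
      exact hxy (by simpa using e.injective (Subtype.ext he))

theorem LabelledBy.representable132Uniform2 {V : Type*} {G : SimpleGraph V} {w : List ℕ}
    {f : V → ℕ} (h : LabelledBy G Set.univ w f) : Representable132Uniform2 G := by
  let H : SimpleGraph ℕ :=
    { Adj := fun x y => x ≠ y ∧ x ∈ w ∧ y ∈ w ∧ Alternate w x y
      symm := ⟨fun x y hxy => ⟨hxy.1.symm, hxy.2.2.1, hxy.2.1, hxy.2.2.2.symm⟩⟩
      loopless := ⟨fun x hx => hx.1 rfl⟩ }
  have hmem : ∀ v, f v ∈ w := fun v => h.bijOn.mapsTo (Set.mem_univ v)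
  have hinj : f.Injective := Set.injOn_univ.1 h.bijOn.injOn
  refine ⟨w, H, h.avoids, h.count_eq_two, ⟨fun x y hxy => hxy.2.1, fun x y hxy hx hy =>
    ⟨fun hA => hA.2.2.2, fun hA => ⟨hxy, hx, hy, hA⟩⟩⟩, ⟨⟨Equiv.ofBijective
      (fun v => ⟨f v, by simpa using hmem v⟩) ⟨fun x y hxy => ?_, ?_⟩, ?_⟩⟩⟩
  · exact hinj (congrArg Subtype.val hxy)
  · rintro ⟨n, hn⟩
    obtain ⟨v, -, hv⟩ := h.bijOn.surjOn (show n ∈ {x | x ∈ w} by simpa using hn)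
    exact ⟨v, Subtype.ext hv⟩
  · intro x y
    change (f x ≠ f y ∧ f x ∈ w ∧ f y ∈ w ∧ Alternate w (f x) (f y)) ↔ G.Adj x y
    constructor
    · rintro ⟨hne, -, -, hA⟩
      exact (h.adj_iff x trivial y trivial (fun e => hne (congrArg f e))).2 hA
    · intro hA
      exact ⟨hinj.ne hA.ne, hmem x, hmem y, (h.adj_iff x trivial y trivial hA.ne).1 hA⟩

/-- Shifting the labels of the first word above those of the second one and concatenating
represents the disjoint union. -/
theorem LabelledBy.exists_union {V : Type*} {G : SimpleGraph V} {S T : Set V} {u v : List ℕ}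
    {f g : V → ℕ} (hS : LabelledBy G S u f) (hT : LabelledBy G T v g) (hST : Disjoint S T)
    (hadj : ∀ x ∈ S, ∀ y ∈ T, ¬ G.Adj x y) : ∃ w k, LabelledBy G (S ∪ T) w k := by
  classical
  obtain ⟨N, hN⟩ : ∃ N, ∀ y ∈ v, y < N :=
    ⟨v.sum + 1, fun y hy => Nat.lt_succ_of_le (List.le_sum_of_mem hy)⟩
  have hinj : Function.Injective (· + N) := add_left_injective N
  have hlt : ∀ x ∈ u.map (· + N), ∀ y ∈ v, y < x := by
    intro x hx y hy
    obtain ⟨z, -, rfl⟩ := List.mem_map.1 hx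
    exact (hN y hy).trans_le (Nat.le_add_left N z)
  have hu : ∀ x ∈ u.map (· + N), x ∉ v := fun x hx hxv => (hlt x hx x hxv).false
  have hv : ∀ x ∈ v, x ∉ u.map (· + N) := fun x hxv hx => hu x hx hxv
  have hcount : ∀ x ∈ u.map (· + N), (u.map (· + N)).count x = 2 := by
    intro x hx
    obtain ⟨z, hz, rfl⟩ := List.mem_map.1 hx
    rw [List.count_map_of_injective u (· + N) hinj, hS.count_eq_two z hz]
  let k : V → ℕ := fun x => if x ∈ S then f x + N else g x
  have hkS : ∀ x ∈ S, k x = f x + N := fun x hx => if_pos hx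
  have hkT : ∀ x ∈ T, k x = g x := fun x hx => if_neg (hST.notMem_of_mem_right hx)
  have hmS : ∀ x ∈ S, k x ∈ u.map (· + N) := fun x hx => by
    rw [hkS x hx]
    exact List.mem_map_of_mem (f := (· + N)) (hS.bijOn.mapsTo hx)
  have hmT : ∀ x ∈ T, k x ∈ v := fun x hx => by
    rw [hkT x hx]
    exact hT.bijOn.mapsTo hx
  have hcross : ∀ x ∈ S, ∀ y ∈ T, ¬ Alternate (u.map (· + N) ++ v) (k x) (k y) :=
    fun x hx y hy => not_alternate_append (hcount _ (hmS x hx)) (hv _ (hmT y hy))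
  refine ⟨u.map (· + N) ++ v, k, (hS.avoids.map fun _ _ h => Nat.add_lt_add_right h N).append
    hT.avoids hlt, fun x hx => ?_, ⟨?_, ?_, ?_⟩, ?_⟩
  · rw [List.count_append]
    rcases List.mem_append.1 hx with hx | hx
    · rw [hcount x hx, List.count_eq_zero_of_not_mem (hu x hx)]
    · rw [hT.count_eq_two x hx, List.count_eq_zero_of_not_mem (hv x hx)]
  · rintro x (hx | hx)
    · exact List.mem_append_left _ (hmS x hx)
    · exact List.mem_append_right _ (hmT x hx)
  · rintro x (hx | hx) y (hy | hy) hxy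
    · rw [hkS x hx, hkS y hy] at hxy
      exact hS.bijOn.injOn hx hy (hinj hxy)
    · exact absurd (hmT y hy) (hxy ▸ hu _ (hmS x hx))
    · exact absurd (hmT x hx) (hxy ▸ hu _ (hmS y hy))
    · rw [hkT x hx, hkT y hy] at hxy
      exact hT.bijOn.injOn hx hy hxy
  · intro n hn
    rcases List.mem_append.1 hn with hn | hn
    · obtain ⟨z, hz, rfl⟩ := List.mem_map.1 hn
      obtain ⟨x, hx, rfl⟩ := hS.bijOn.surjOn hz
      exact ⟨x, Or.inl hx, hkS x hx⟩
    · obtain ⟨x, hx, rfl⟩ := hT.bijOn.surjOn hn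
      exact ⟨x, Or.inr hx, hkT x hx⟩
  · rintro x (hx | hx) y (hy | hy) hxy
    · rw [alternate_append_iff_left (hu _ (hmS x hx)) (hu _ (hmS y hy)), hkS x hx, hkS y hy,
        alternate_map_iff hinj]
      exact hS.adj_iff x hx y hy hxy
    · exact iff_of_false (hadj x hx y hy) (hcross x hx y hy)
    · exact iff_of_false (fun h => hadj y hy x hx h.symm) (fun h => hcross y hy x hx h.symm)
    · rw [alternate_append_iff_right (hv _ (hmT x hx)) (hv _ (hmT y hy)), hkT x hx, hkT y hy]
      exact hT.adj_iff x hx y hy hxy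

theorem Representable132Uniform2.representable132 {V : Type*} {G : SimpleGraph V}
    (h : Representable132Uniform2 G) : Representable132 G := by
  obtain ⟨w, H, hw, -, hH, e⟩ := h
  exact ⟨w, H, hw, hH, e⟩

/-- If every connected component of a finite simple graph `G` is 132-representable
by a 2-uniform word, then so is `G`; in particular, `G` is 132-representable. -/
theorem representable132_of_components {V : Type*} [Fintype V] (G : SimpleGraph V)
    (h : ∀ c : G.ConnectedComponent, Representable132Uniform2 (G.induce c.supp)) :
    Representable132Uniform2 G ∧ Representable132 G := by
  classical
  have key : ∀ s : Finset G.ConnectedComponent,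
      ∃ w f, LabelledBy G {v | G.connectedComponentMk v ∈ s} w f := by
    intro s
    induction s using Finset.induction_on with
    | empty => exact ⟨[], fun _ => 0, by simpa using labelledBy_empty G _⟩
    | insert c s hc ih =>
      obtain ⟨u, f, hu⟩ := (h c).exists_labelledBy
      obtain ⟨v, g, hv⟩ := ih
      have hS : {v | G.connectedComponentMk v ∈ insert c s} =
          c.supp ∪ {v | G.connectedComponentMk v ∈ s} := by
        ext v
        simp [SimpleGraph.ConnectedComponent.mem_supp_iff]
      rw [hS]
      refine hu.exists_union hv (Set.disjoint_left.2 ?_) ?_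
      · rintro x rfl hx
        exact hc hx
      · rintro x rfl y hy hxy
        rw [Set.mem_ofPred_eq, ← SimpleGraph.ConnectedComponent.connectedComponentMk_eq_of_adj hxy]
          at hy
        exact hc hy
  obtain ⟨w, f, hw⟩ := key Finset.univ
  simp only [Finset.mem_univ, Set.ofPred_true] at hw
  exact ⟨hw.representable132Uniform2, hw.representable132Uniform2.representable132⟩
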